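/- Let H be a Hilbert space, Φ a contraction in expectation with constant r < 1 (E[‖Φ(x,ξ)−Φ(y,ξ)‖²] ≤ r²‖x−y‖² for all x,y), and suppose there exists y ∈ H with E[‖Φ(y,ξ)−y‖²] < ∞, so that 𝒫 has a unique invariant measure π ∈ P₂(H). If the Markov transport discrepancy Ψ satisfies Ψ(μ) ≥ q·W₂(μ𝒫, μ) for all μ ∈ P₂(H) for some q > 0, then Ψ is linearly metrically subregular for 0 relative to P₂(H) on P₂(H) with gauge ρ(t) = t/(q(1−r)); explicitly, Ψ⁻¹(0) ∩ P₂(H) = {π} and W₂(μ, π) ≤ Ψ(μ)/(q(1−r)) for all μ ∈ P₂(H). -/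

import Mathlib

open MeasureTheory Filter Topology

noncomputable section

/-- One application of the dual Markov operator of the RFI, with `μξ` the law of `ξ`. -/
def markovStep {G I : Type*} [MeasurableSpace G] [MeasurableSpace I]
    (μξ : MeasureTheory.Measure I) (T : I → G → G) (μ : MeasureTheory.Measure G) :
    MeasureTheory.Measure G :=
  μ.bind fun x => μξ.map fun i => T i x

/-- Squared distance `‖x - y‖²` as an extended nonnegative real. -/
def q2 {H : Type*} [NormedAddCommGroup H] (x y : H) : ENNReal :=
  (‖x - y‖₊ : ENNReal) ^ 2

/-- `γ` is a coupling of `(μ, ν)`: a measure on the product with marginals `μ` and `ν`. -/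
def IsCoupling {H : Type*} [MeasurableSpace H]
    (γ : MeasureTheory.Measure (H × H)) (μ ν : MeasureTheory.Measure H) : Prop :=
  γ.map Prod.fst = μ ∧ γ.map Prod.snd = ν

/-- The squared Wasserstein-2 distance `W₂(μ,ν)²`. -/
def W2sq {H : Type*} [MeasurableSpace H] [NormedAddCommGroup H]
    (μ ν : MeasureTheory.Measure H) : ENNReal :=
  ⨅ (γ : MeasureTheory.Measure (H × H)) (_ : IsCoupling γ μ ν), ∫⁻ p, q2 p.1 p.2 ∂γ

/-- An optimal coupling of `(μ, ν)`: a coupling attaining `W₂(μ,ν)²`. -/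
def IsOptCoupling {H : Type*} [MeasurableSpace H] [NormedAddCommGroup H]
    (γ : MeasureTheory.Measure (H × H)) (μ ν : MeasureTheory.Measure H) : Prop :=
  IsCoupling γ μ ν ∧ ∫⁻ p, q2 p.1 p.2 ∂γ = W2sq μ ν

/-- Membership in `P₂(H)`: probability measures with finite second moment. -/
def MemP2 {H : Type*} [MeasurableSpace H] [NormedAddCommGroup H]
    (μ : MeasureTheory.Measure H) : Prop :=
  MeasureTheory.IsProbabilityMeasure μ ∧ ∃ x : H, ∫⁻ y, q2 x y ∂μ < ⊤


/-- The set of invariant probability measures of the RFI Markov operator. -/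
def invSet {H I : Type*} [MeasurableSpace H] [MeasurableSpace I]
    (μξ : MeasureTheory.Measure I) (T : I → H → H) : Set (MeasureTheory.Measure H) :=
  {π | MeasureTheory.IsProbabilityMeasure π ∧ markovStep μξ T π = π}

/-- The squared Markov transport discrepancy
`Ψ(μ)² = inf_{π' ∈ inv 𝒫} inf_{γ optimal coupling of (μ,π')} ∫ E[‖(x-Φ(x,ξ))-(y-Φ(y,ξ))‖²] dγ`,
equal to `+∞` when `inv 𝒫` is empty or no optimal coupling exists. -/
def PsiSq {H I : Type*} [MeasurableSpace H] [NormedAddCommGroup H] [MeasurableSpace I]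
    (μξ : MeasureTheory.Measure I) (T : I → H → H) (μ : MeasureTheory.Measure H) :
    ENNReal :=
  ⨅ (π' : MeasureTheory.Measure H) (_ : π' ∈ invSet μξ T)
    (γ : MeasureTheory.Measure (H × H)) (_ : IsOptCoupling γ μ π'),
      ∫⁻ p, (∫⁻ i, q2 (p.1 - T i p.1) (p.2 - T i p.2) ∂μξ) ∂γ

open scoped ProbabilityTheory

section Coupling

variable {H Ω : Type*} [MeasurableSpace H] [MeasurableSpace Ω]

lemma IsCoupling.isProbabilityMeasure {γ : Measure (H × H)} {μ ν : Measure H}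
    [IsProbabilityMeasure μ] (h : IsCoupling γ μ ν) : IsProbabilityMeasure γ := by
  have h1 : IsProbabilityMeasure (γ.map Prod.fst) := h.1 ▸ inferInstance
  exact Measure.isProbabilityMeasure_of_map Prod.fst

lemma IsCoupling.swap {γ : Measure (H × H)} {μ ν : Measure H}
    (h : IsCoupling γ μ ν) : IsCoupling (γ.map Prod.swap) ν μ := by
  constructor
  · rw [Measure.map_map measurable_fst measurable_swap]; exact h.2
  · rw [Measure.map_map measurable_snd measurable_swap]; exact h.1

lemma isCoupling_map_diag (μ : Measure H) : IsCoupling (μ.map fun x => (x, x)) μ μ := by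
  have hd : Measurable fun x : H => (x, x) := by fun_prop
  constructor
  · rw [Measure.map_map measurable_fst hd]; exact Measure.map_id
  · rw [Measure.map_map measurable_snd hd]; exact Measure.map_id

lemma isCoupling_prod (μ ν : Measure H) [IsProbabilityMeasure μ] [IsProbabilityMeasure ν] :
    IsCoupling (μ.prod ν) μ ν :=
  ⟨by simp [Measure.map_fst_prod], by simp [Measure.map_snd_prod]⟩

lemma map_compProd_comap_snd {G : Type*} [MeasurableSpace G] (γ : Measure (G × H)) [SFinite γ]
    (κ : ProbabilityTheory.Kernel H Ω) [ProbabilityTheory.IsSFiniteKernel κ] :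
    (γ ⊗ₘ κ.comap Prod.snd measurable_snd).map (Prod.map Prod.snd id) =
      γ.map Prod.snd ⊗ₘ κ := by
  ext s hs
  have hm : Measurable (Prod.map Prod.snd id : (G × H) × Ω → H × Ω) :=
    measurable_snd.prodMap measurable_id
  rw [Measure.map_apply hm hs, Measure.compProd_apply (hm hs), Measure.compProd_apply hs,
    lintegral_map (ProbabilityTheory.Kernel.measurable_kernel_prodMk_left hs) measurable_snd]
  rfl

end Coupling

section Wasserstein

variable {H Ω : Type*} [NormedAddCommGroup H] [MeasurableSpace Ω]

lemma lintegral_q2 (P : Measure Ω) (f g : Ω → H) :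
    ∫⁻ ω, q2 (f ω) (g ω) ∂P = eLpNorm (fun ω => f ω - g ω) 2 P ^ 2 := by
  have h := eLpNorm_nnreal_pow_eq_lintegral (f := fun ω => f ω - g ω) (μ := P) (p := 2) (by simp)
  norm_num at h
  simpa [q2, enorm_eq_nnnorm] using h.symm

lemma q2_comm (x y : H) : q2 x y = q2 y x := by
  simp only [q2, ← enorm_eq_nnnorm, enorm_sub_rev]

variable [MeasurableSpace H]

lemma W2sq_le {γ : Measure (H × H)} {μ ν : Measure H} (h : IsCoupling γ μ ν) :
    W2sq μ ν ≤ ∫⁻ p, q2 p.1 p.2 ∂γ :=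
  iInf₂_le γ h

lemma W2sq_rpow_half (μ ν : Measure H) :
    W2sq μ ν ^ (1 / 2 : ℝ) = ⨅ (γ : Measure (H × H)) (_ : IsCoupling γ μ ν),
      eLpNorm (fun p : H × H => p.1 - p.2) 2 γ := by
  have h := (ENNReal.orderIsoRpow (1 / 2) (by norm_num)).map_iInf₂
    fun (γ : Measure (H × H)) (_ : IsCoupling γ μ ν) => ∫⁻ p, q2 p.1 p.2 ∂γ
  simp only [ENNReal.orderIsoRpow_apply] at h
  rw [W2sq, h]
  congr! 4 with γ hγ
  rw [lintegral_q2, ← ENNReal.rpow_natCast, ← ENNReal.rpow_mul]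
  norm_num

variable [SecondCountableTopology H] [BorelSpace H]

lemma measurable_q2 : Measurable fun p : H × H => q2 p.1 p.2 := by
  unfold q2; fun_prop

lemma Measurable.q2 {f g : Ω → H} (hf : Measurable f) (hg : Measurable g) :
    Measurable fun ω => q2 (f ω) (g ω) :=
  measurable_q2.comp (hf.prodMk hg)

lemma W2sq_comm_le (μ ν : Measure H) : W2sq ν μ ≤ W2sq μ ν := by
  refine le_iInf₂ fun γ hγ => (W2sq_le hγ.swap).trans_eq ?_
  rw [lintegral_map measurable_q2 measurable_swap]
  exact lintegral_congr fun p => q2_comm _ _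

lemma W2sq_comm (μ ν : Measure H) : W2sq μ ν = W2sq ν μ :=
  (W2sq_comm_le ν μ).antisymm (W2sq_comm_le μ ν)

lemma lintegral_q2_map_diag (μ : Measure H) :
    ∫⁻ p, q2 p.1 p.2 ∂(μ.map fun x => (x, x)) = 0 := by
  rw [lintegral_map measurable_q2 (by fun_prop)]
  simp [q2]

lemma isOptCoupling_map_diag (μ : Measure H) : IsOptCoupling (μ.map fun x => (x, x)) μ μ := by
  refine ⟨isCoupling_map_diag μ, ?_⟩
  have h := W2sq_le (isCoupling_map_diag μ)
  rw [lintegral_q2_map_diag] at h ⊢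
  exact (le_antisymm h bot_le).symm

/-- The triangle inequality for `W₂`, by gluing couplings along their common marginal. -/
lemma W2sq_triangle [CompleteSpace H] (μ ν ρ : Measure H) [IsProbabilityMeasure μ]
    [IsProbabilityMeasure ν] :
    W2sq μ ρ ^ (1 / 2 : ℝ) ≤ W2sq μ ν ^ (1 / 2 : ℝ) + W2sq ν ρ ^ (1 / 2 : ℝ) := by
  rw [W2sq_rpow_half μ ν, W2sq_rpow_half ν ρ]
  simp only [ENNReal.iInf_add, ENNReal.add_iInf]
  refine le_iInf₂ fun γ' hγ' => le_iInf₂ fun γ hγ => ?_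
  rw [W2sq_rpow_half]
  have := hγ.isProbabilityMeasure
  have := hγ'.isProbabilityMeasure
  set θ : Measure ((H × H) × H) := γ ⊗ₘ γ'.condKernel.comap Prod.snd measurable_snd with hθ
  have h1 : θ.map Prod.fst = γ := Measure.fst_compProd _ _
  have h2 : θ.map (Prod.map Prod.snd id) = γ' := by
    rw [hθ, map_compProd_comap_snd, hγ.2, ← hγ'.1]
    exact γ'.disintegrate γ'.condKernel
  have hm1 : Measurable fun t : (H × H) × H => (t.1.1, t.2) := by fun_prop
  have hm2 : Measurable (Prod.map Prod.snd id : (H × H) × H → H × H) :=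
    measurable_snd.prodMap measurable_id
  have hc : IsCoupling (θ.map fun t => (t.1.1, t.2)) μ ρ := by
    constructor
    · rw [Measure.map_map measurable_fst hm1, ← hγ.1, ← h1,
        Measure.map_map measurable_fst measurable_fst]
      rfl
    · rw [Measure.map_map measurable_snd hm1, ← hγ'.2, ← h2,
        Measure.map_map measurable_snd hm2]
      rfl
  have hs : Measurable fun p : H × H => p.1 - p.2 := by fun_prop
  refine (iInf₂_le (θ.map fun t => (t.1.1, t.2)) hc).trans ?_
  conv_rhs => rw [← h1, ← h2]
  rw [eLpNorm_map_measure hs.aestronglyMeasurable hm1.aemeasurable,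
    eLpNorm_map_measure hs.aestronglyMeasurable measurable_fst.aemeasurable,
    eLpNorm_map_measure hs.aestronglyMeasurable hm2.aemeasurable]
  refine le_trans (le_of_eq ?_) (eLpNorm_add_le
    (hs.comp measurable_fst).aestronglyMeasurable (hs.comp hm2).aestronglyMeasurable one_le_two)
  congr 1
  ext t
  simp

lemma measure_isClosed_le_of_W2sq_eq_zero {μ ν : Measure H} [IsFiniteMeasure ν]
    (h : W2sq μ ν = 0) {F : Set H} (hF : IsClosed F) : μ F ≤ ν F := by
  have key : ∀ ε : ℝ, 0 < ε → μ F ≤ ν (Metric.cthickening ε F) := by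
    intro ε hε
    have hε0 : ENNReal.ofReal ε ^ 2 ≠ 0 := by simpa using hε
    have hεt : ENNReal.ofReal ε ^ 2 ≠ ⊤ := by simp
    refine ENNReal.le_of_forall_pos_le_add fun δ hδ _ => ?_
    have hlt : W2sq μ ν < ENNReal.ofReal ε ^ 2 * δ := by
      rw [h]
      exact ENNReal.mul_pos hε0 (by simpa using hδ.ne')
    obtain ⟨γ, hγ, hcost⟩ : ∃ γ, ∃ _ : IsCoupling γ μ ν,
        ∫⁻ p, q2 p.1 p.2 ∂γ < ENNReal.ofReal ε ^ 2 * δ := by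
      simpa only [W2sq, iInf_lt_iff] using hlt
    have hmk := meas_ge_le_lintegral_div (μ := γ) measurable_q2.aemeasurable hε0 hεt
    have hsub : Prod.fst ⁻¹' F ⊆ Prod.snd ⁻¹' (Metric.cthickening ε F) ∪
        {p : H × H | ENNReal.ofReal ε ^ 2 ≤ q2 p.1 p.2} := by
      intro p hp
      by_cases hd : ENNReal.ofReal ε ^ 2 ≤ q2 p.1 p.2
      · exact Or.inr hd
      · left
        have hd' : ‖p.1 - p.2‖ₑ < ENNReal.ofReal ε := by
          by_contra! hcon
          exact hd (by simpa [q2, enorm_eq_nnnorm] using pow_le_pow_left' hcon 2)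
        refine (Metric.infEDist_le_edist_of_mem (s := F) hp).trans ?_
        rw [edist_comm, edist_eq_enorm_sub]
        exact hd'.le
    calc μ F = γ (Prod.fst ⁻¹' F) := by
          rw [← hγ.1, Measure.map_apply measurable_fst hF.measurableSet]
      _ ≤ γ (Prod.snd ⁻¹' (Metric.cthickening ε F)) +
          γ {p : H × H | ENNReal.ofReal ε ^ 2 ≤ q2 p.1 p.2} :=
        (measure_mono hsub).trans (measure_union_le _ _)
      _ ≤ ν (Metric.cthickening ε F) + δ := by
        gcongr
        · rw [← hγ.2, Measure.map_apply measurable_snd Metric.isClosed_cthickening.measurableSet]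
        · refine hmk.trans (ENNReal.div_le_of_le_mul ?_)
          rw [mul_comm]
          exact hcost.le
  have ht := tendsto_measure_cthickening_of_isClosed (μ := ν)
    ⟨1, one_pos, measure_ne_top _ _⟩ hF
  refine ge_of_tendsto (ht.mono_left (nhdsWithin_le_nhds (s := Set.Ioi 0))) ?_
  filter_upwards [self_mem_nhdsWithin] with ε hε using key ε hε

lemma eq_of_W2sq_eq_zero {μ ν : Measure H} [IsProbabilityMeasure μ] [IsProbabilityMeasure ν]
    (h : W2sq μ ν = 0) : μ = ν := by
  refine ext_of_generate_finite _ ?_ isPiSystem_isClosed (fun F hF => ?_) (by simp)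
  · rw [BorelSpace.measurable_eq (α := H), borel_eq_generateFrom_isClosed]
  · exact (measure_isClosed_le_of_W2sq_eq_zero h hF).antisymm
      (measure_isClosed_le_of_W2sq_eq_zero (W2sq_comm μ ν ▸ h) hF)

lemma MemP2.memLp_id {μ : Measure H} (hμ : MemP2 μ) : MemLp id 2 μ := by
  have := hμ.1
  obtain ⟨x, hx⟩ := hμ.2
  rw [lintegral_q2 μ (fun _ => x) (fun y => y)] at hx
  have h1 : MemLp (fun y : H => x - y) 2 μ :=
    ⟨by fun_prop, lt_top_iff_ne_top.2 fun hcon => by simp [hcon] at hx⟩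
  refine ((memLp_const x).sub h1).congr_norm (by fun_prop) ?_
  filter_upwards with y
  simp

lemma W2sq_ne_top {μ ν : Measure H} (hμ : MemP2 μ) (hν : MemP2 ν) : W2sq μ ν ≠ ⊤ := by
  have := hμ.1
  have := hν.1
  refine ne_top_of_le_ne_top ?_ (W2sq_le (isCoupling_prod μ ν))
  rw [lintegral_q2 _ Prod.fst Prod.snd]
  exact ENNReal.pow_ne_top ((hμ.memLp_id.comp_fst ν).sub (hν.memLp_id.comp_snd μ)).2.ne

end Wasserstein

section InfiniteProduct

variable {I : Type*} [MeasurableSpace I]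

lemma measurePreserving_natCases (ν : Measure I) [IsProbabilityMeasure ν] :
    MeasurePreserving (fun (p : I × (ℕ → I)) (n : ℕ) => Nat.casesOn n p.1 p.2)
      (ν.prod (Measure.infinitePi fun _ : ℕ => ν)) (Measure.infinitePi fun _ : ℕ => ν) := by
  classical
  have hm : Measurable fun (p : I × (ℕ → I)) (n : ℕ) =>
      (Nat.casesOn n p.1 p.2 : I) := by
    refine measurable_pi_iff.2 fun n => ?_
    cases n with
    | zero => exact measurable_fst
    | succ n => exact (measurable_pi_apply n).comp measurable_snd
  refine ⟨hm, Measure.eq_infinitePi _ fun s t ht => ?_⟩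
  set t' : ℕ → Set I := fun n => if n ∈ s then t n else Set.univ with ht'
  have htm : ∀ n, MeasurableSet (t' n) := fun n => by
    simp only [ht']; split_ifs; exacts [ht n, MeasurableSet.univ]
  obtain ⟨N, hN⟩ : ∃ N, s ⊆ Finset.range (N + 1) :=
    ⟨s.sup id, fun n hn => by simpa [Nat.lt_succ_iff] using Finset.le_sup (f := id) hn⟩
  have hpre : (fun (p : I × (ℕ → I)) (n : ℕ) => (Nat.casesOn n p.1 p.2 : I)) ⁻¹'
      Set.pi s t = t' 0 ×ˢ Set.pi (Finset.range N) fun n => t' (n + 1) := by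
    ext p
    simp only [Set.mem_preimage, Set.mem_pi, Set.mem_prod, Finset.mem_coe, ht']
    constructor
    · intro h
      constructor
      · split_ifs with h0
        exacts [h 0 h0, trivial]
      · intro n _
        split_ifs with hn
        exacts [h (n + 1) hn, trivial]
    · rintro ⟨h0, h1⟩ n hn
      cases n with
      | zero => simpa [hn] using h0
      | succ n =>
        have hlt : n < N := by simpa using hN hn
        simpa [hn] using h1 n (by simpa using hlt)
  have hs : ∏ n ∈ s, ν (t n) = ∏ n ∈ Finset.range (N + 1), ν (t' n) := by
    rw [← Finset.prod_subset hN]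
    · exact Finset.prod_congr rfl fun n hn => by simp [ht', hn]
    · intro n _ hn
      simp [ht', hn]
  rw [Measure.map_apply hm (MeasurableSet.pi s.countable_toSet fun n _ => ht n), hpre,
    Measure.prod_prod, Measure.infinitePi_pi _ fun n _ => htm (n + 1), hs,
    Finset.prod_range_succ', mul_comm]

lemma measurePreserving_head_tail (ν : Measure I) [IsProbabilityMeasure ν] :
    MeasurePreserving (fun ω : ℕ → I => (ω 0, fun n => ω (n + 1)))
      (Measure.infinitePi fun _ : ℕ => ν) (ν.prod (Measure.infinitePi fun _ : ℕ => ν)) := by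
  have hm : Measurable fun ω : ℕ → I => (ω 0, fun n => ω (n + 1)) := by fun_prop
  refine ⟨hm, ?_⟩
  have hc := measurePreserving_natCases ν
  conv_lhs => rw [← hc.map_eq]
  rw [Measure.map_map hm hc.measurable]
  exact Measure.map_id

end InfiniteProduct

section RandomFunctionIteration

variable {H I : Type*} [MeasurableSpace H] [MeasurableSpace I] {T : I → H → H}
  {μξ : Measure I} [IsProbabilityMeasure μξ]

lemma markovStep_eq_map (hΦ : Measurable fun p : H × I => T p.2 p.1) (μ : Measure H)
    [SFinite μ] :
    markovStep μξ T μ = (μ.prod μξ).map fun p => T p.2 p.1 := by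
  have hT : ∀ x, Measurable fun i => T i x := fun x => hΦ.comp measurable_prodMk_left
  have hk : Measurable fun x => μξ.map fun i => T i x := by
    refine Measure.measurable_of_measurable_coe _ fun s hs => ?_
    simp_rw [Measure.map_apply (hT _) hs]
    exact measurable_measure_prodMk_left (hΦ hs)
  ext s hs
  rw [markovStep, Measure.bind_apply hs hk.aemeasurable, Measure.map_apply hΦ hs,
    Measure.prod_apply (hΦ hs)]
  refine lintegral_congr fun x => ?_
  rw [Measure.map_apply (hT x) hs]
  rfl

lemma isProbabilityMeasure_markovStep (hΦ : Measurable fun p : H × I => T p.2 p.1)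
    (μ : Measure H) [IsProbabilityMeasure μ] : IsProbabilityMeasure (markovStep μξ T μ) := by
  rw [markovStep_eq_map hΦ]
  exact Measure.isProbabilityMeasure_map hΦ.aemeasurable

variable [NormedAddCommGroup H] [SecondCountableTopology H] [BorelSpace H] {c : ENNReal}

lemma W2sq_markovStep_le (hΦ : Measurable fun p : H × I => T p.2 p.1)
    (hcontr : ∀ x y : H, ∫⁻ i, q2 (T i x) (T i y) ∂μξ ≤ c * q2 x y)
    (μ ν : Measure H) [IsProbabilityMeasure μ] [IsProbabilityMeasure ν] :
    W2sq (markovStep μξ T μ) (markovStep μξ T ν) ≤ c * W2sq μ ν := by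
  have hne : Nonempty {γ : Measure (H × H) // IsCoupling γ μ ν} := ⟨_, isCoupling_prod μ ν⟩
  have hW : W2sq μ ν = ⨅ γ : {γ : Measure (H × H) // IsCoupling γ μ ν},
      ∫⁻ p, q2 p.1 p.2 ∂γ.1 := by rw [W2sq, iInf_subtype]
  by_cases hc : c = ⊤
  · subst hc
    by_cases h0 : W2sq μ ν = 0
    · rw [eq_of_W2sq_eq_zero h0]
      exact (W2sq_le (isCoupling_map_diag _)).trans (by rw [lintegral_q2_map_diag]; exact zero_le)
    · simp [ENNReal.top_mul h0]
  rw [hW, ENNReal.mul_iInf fun h => absurd h hc]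
  refine le_iInf fun ⟨γ, hγ⟩ => ?_
  have := hγ.isProbabilityMeasure
  have hm1 : Measurable fun t : (H × H) × I => T t.2 t.1.1 :=
    hΦ.comp (by fun_prop : Measurable fun t : (H × H) × I => (t.1.1, t.2))
  have hm2 : Measurable fun t : (H × H) × I => T t.2 t.1.2 :=
    hΦ.comp (by fun_prop : Measurable fun t : (H × H) × I => (t.1.2, t.2))
  have hcpl : IsCoupling ((γ.prod μξ).map fun t => (T t.2 t.1.1, T t.2 t.1.2))
      (markovStep μξ T μ) (markovStep μξ T ν) := by
    rw [markovStep_eq_map hΦ, markovStep_eq_map hΦ]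
    have hI : μξ = μξ.map id := Measure.map_id.symm
    constructor
    · rw [Measure.map_map measurable_fst (hm1.prodMk hm2), ← hγ.1, hI,
        Measure.map_prod_map _ _ measurable_fst measurable_id,
        Measure.map_map hΦ (measurable_fst.prodMap measurable_id), Measure.map_id]
      rfl
    · rw [Measure.map_map measurable_snd (hm1.prodMk hm2), ← hγ.2, hI,
        Measure.map_prod_map _ _ measurable_snd measurable_id,
        Measure.map_map hΦ (measurable_snd.prodMap measurable_id), Measure.map_id]
      rfl
  refine (W2sq_le hcpl).trans ?_
  rw [lintegral_map measurable_q2 (hm1.prodMk hm2)]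
  dsimp only
  rw [lintegral_prod _ (hm1.q2 hm2).aemeasurable,
    ← lintegral_const_mul _ measurable_q2]
  exact lintegral_mono fun p => hcontr p.1 p.2

lemma eLpNorm_comp_contraction_sq_le {Ω : Type*} [MeasurableSpace Ω] {P : Measure Ω}
    [SFinite P] {sh : Ω → I × Ω} (hsh : MeasurePreserving sh P (μξ.prod P))
    (hΦ : Measurable fun p : H × I => T p.2 p.1)
    (hcontr : ∀ x y : H, ∫⁻ i, q2 (T i x) (T i y) ∂μξ ≤ c * q2 x y)
    {X Y : Ω → H} (hX : Measurable X) (hY : Measurable Y) :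
    eLpNorm (fun ω => T (sh ω).1 (X (sh ω).2) - T (sh ω).1 (Y (sh ω).2)) 2 P ^ 2 ≤
      c * eLpNorm (fun ω => X ω - Y ω) 2 P ^ 2 := by
  have hm : ∀ {Z : Ω → H}, Measurable Z → Measurable fun p : I × Ω => T p.1 (Z p.2) :=
    fun hZ => hΦ.comp ((hZ.comp measurable_snd).prodMk measurable_fst)
  have hq : Measurable fun p : I × Ω => q2 (T p.1 (X p.2)) (T p.1 (Y p.2)) :=
    (hm hX).q2 (hm hY)
  rw [← lintegral_q2, ← lintegral_q2, hsh.lintegral_comp hq, lintegral_prod_symm _ hq.aemeasurable,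
    ← lintegral_const_mul _ (hX.q2 hY)]
  exact lintegral_mono fun ω => hcontr _ _

lemma exists_memP2_markovStep_eq [CompleteSpace H]
    (hΦ : Measurable fun p : H × I => T p.2 p.1) {K : NNReal} (hK : K < 1)
    (hcontr : ∀ x y : H, ∫⁻ i, q2 (T i x) (T i y) ∂μξ ≤ (K : ENNReal) ^ 2 * q2 x y)
    (hfin : ∃ y₀ : H, ∫⁻ i, q2 (T i y₀) y₀ ∂μξ < ⊤) :
    ∃ π : Measure H, MemP2 π ∧ markovStep μξ T π = π := by
  set P : Measure (ℕ → I) := Measure.infinitePi fun _ => μξ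
  set sh : (ℕ → I) → I × (ℕ → I) := fun ω => (ω 0, fun n => ω (n + 1))
  have hsh : MeasurePreserving sh P (μξ.prod P) := measurePreserving_head_tail μξ
  have hm : ∀ {Z : (ℕ → I) → H}, Measurable Z → Measurable fun ω => T (sh ω).1 (Z (sh ω).2) :=
    fun hZ => hΦ.comp
      ((hZ.comp (measurable_snd.comp hsh.measurable)).prodMk
        (measurable_fst.comp hsh.measurable))
  have hle : ∀ {X Y : (ℕ → I) → H}, Measurable X → Measurable Y →
      eLpNorm (fun ω => T (sh ω).1 (X (sh ω).2) - T (sh ω).1 (Y (sh ω).2)) 2 P ≤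
        K * eLpNorm (fun ω => X ω - Y ω) 2 P := by
    intro X Y hX hY
    have h := eLpNorm_comp_contraction_sq_le hsh hΦ hcontr hX hY
    rw [← mul_pow] at h
    exact (ENNReal.pow_le_pow_left_iff two_ne_zero).1 h
  obtain ⟨y₀, hy₀⟩ := hfin
  have hmem0 : MemLp (fun ω => T (sh ω).1 y₀) 2 P := by
    have h1 : MemLp (fun ω => T (sh ω).1 y₀ - y₀) 2 P := by
      have hmy : Measurable fun i => T i y₀ := hΦ.comp measurable_prodMk_left
      refine ⟨((hm (measurable_const (a := y₀))).sub_const _).aestronglyMeasurable,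
        lt_top_iff_ne_top.2 fun hcon => ?_⟩
      have hq : Measurable fun i => q2 (T i y₀) y₀ :=
        hmy.q2 measurable_const
      have hmp : MeasurePreserving (fun ω => (sh ω).1) P μξ := measurePreserving_fst.comp hsh
      rw [← hmp.lintegral_comp hq, lintegral_q2 P _ fun _ => y₀, hcon] at hy₀
      simp at hy₀
    convert h1.add (memLp_const y₀) using 1
    ext ω
    simp
  have hmem : ∀ X : Lp H 2 P, MemLp (fun ω => T (sh ω).1 (X (sh ω).2)) 2 P := by
    intro X
    have hX : Measurable X := (Lp.stronglyMeasurable X).measurable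
    have h1 : MemLp (fun ω => T (sh ω).1 (X (sh ω).2) - T (sh ω).1 y₀) 2 P :=
      ⟨((hm hX).sub (hm (measurable_const (a := y₀)))).aestronglyMeasurable,
        (hle hX measurable_const).trans_lt (ENNReal.mul_lt_top ENNReal.coe_lt_top
          ((Lp.memLp X).sub (memLp_const y₀)).2)⟩
    convert h1.add hmem0 using 1
    ext ω
    simp
  set S : Lp H 2 P → Lp H 2 P := fun X => (hmem X).toLp _
  have hS : ContractingWith K S := by
    refine ⟨hK, fun X Y => ?_⟩
    rw [Lp.edist_toLp_toLp, Lp.edist_def]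
    exact hle (Lp.stronglyMeasurable X).measurable (Lp.stronglyMeasurable Y).measurable
  set X := hS.fixedPoint S
  have hX : Measurable X := (Lp.stronglyMeasurable X).measurable
  have hfix : (fun ω => T (sh ω).1 (X (sh ω).2)) =ᵐ[P] X := by
    have h := (hmem X).coeFn_toLp
    have hX' : (hmem X).toLp _ = X := hS.fixedPoint_isFixedPt
    rw [hX'] at h
    exact h.symm
  refine ⟨P.map X, ⟨Measure.isProbabilityMeasure_map hX.aemeasurable, 0, ?_⟩, ?_⟩
  · rw [lintegral_map (measurable_const.q2 (g := fun y => y) measurable_id) hX,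
      lintegral_q2 P (fun _ => 0) X]
    exact ENNReal.pow_lt_top ((memLp_const 0).sub (Lp.memLp X)).2
  · have := Measure.isProbabilityMeasure_map (μ := P) hX.aemeasurable
    rw [markovStep_eq_map hΦ]
    conv_rhs => rw [← Measure.map_congr hfix]
    have hmp : (P.map X).prod μξ = P.map fun ω => (X (sh ω).2, (sh ω).1) := by
      have hXs : Measurable fun p : I × (ℕ → I) => (X p.2, p.1) := by fun_prop
      have h1 : P.map (fun ω => (X (sh ω).2, (sh ω).1)) =
          (P.map sh).map fun p => (X p.2, p.1) := by
        rw [Measure.map_map hXs hsh.measurable]; rfl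
      rw [h1, hsh.map_eq, ← Measure.prod_swap (μ := P) (ν := μξ),
        Measure.map_map hXs measurable_swap]
      conv_lhs => rw [← Measure.map_id (μ := μξ), Measure.map_prod_map _ _ hX measurable_id]
      rfl
    rw [hmp, Measure.map_map hΦ (by fun_prop)]
    rfl

lemma mul_W2sq_le_W2sq_markovStep [CompleteSpace H]
    (hΦ : Measurable fun p : H × I => T p.2 p.1) {r : ℝ} (hr0 : 0 ≤ r) (hr1 : r < 1)
    (hcontr : ∀ x y : H, ∫⁻ i, q2 (T i x) (T i y) ∂μξ ≤ ENNReal.ofReal (r ^ 2) * q2 x y)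
    {μ π : Measure H} (hμ : MemP2 μ) (hπ : MemP2 π) (hinv : markovStep μξ T π = π) :
    ENNReal.ofReal ((1 - r) ^ 2) * W2sq μ π ≤ W2sq (markovStep μξ T μ) μ := by
  have := hμ.1
  have := hπ.1
  have := isProbabilityMeasure_markovStep (μξ := μξ) hΦ μ
  have hsq : ∀ x : ENNReal, (x ^ (1 / 2 : ℝ)) ^ 2 = x := fun x => by
    rw [← ENNReal.rpow_natCast, ← ENNReal.rpow_mul]; norm_num
  have htri := W2sq_triangle μ (markovStep μξ T μ) π
  have hcon := W2sq_markovStep_le hΦ hcontr μ π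
  rw [hinv, ENNReal.ofReal_pow hr0] at hcon
  rw [W2sq_comm μ (markovStep μξ T μ)] at htri
  have hW := W2sq_ne_top hμ hπ
  rw [← hsq (W2sq μ π)] at hcon hW ⊢
  rw [← hsq (W2sq (markovStep μξ T μ) π), ← mul_pow,
    ENNReal.pow_le_pow_left_iff two_ne_zero] at hcon
  rw [← hsq (W2sq (markovStep μξ T μ) μ), ENNReal.ofReal_pow (by linarith), ← mul_pow]
  refine pow_le_pow_left' ?_ 2
  generalize W2sq μ π ^ (1 / 2 : ℝ) = w at *
  have hw : w ≠ ⊤ := fun h => hW (by simp [h])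
  have hrw : ENNReal.ofReal r * w ≠ ⊤ := ENNReal.mul_ne_top ENNReal.ofReal_ne_top hw
  refine ENNReal.le_of_add_le_add_right hrw ?_
  rw [← add_mul, ← ENNReal.ofReal_add (by linarith) hr0, sub_add_cancel, ENNReal.ofReal_one,
    one_mul]
  exact htri.trans (by gcongr)

lemma PsiSq_eq_zero {π : Measure H} (hπ : π ∈ invSet μξ T)
    (hΦ : Measurable fun p : H × I => T p.2 p.1) : PsiSq μξ T π = 0 := by
  refine le_antisymm ?_ bot_le
  refine (iInf₂_le π hπ).trans
    ((iInf₂_le (π.map fun x => (x, x)) (isOptCoupling_map_diag π)).trans ?_)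
  have hm : Measurable fun t : (H × H) × I => q2 (t.1.1 - T t.2 t.1.1) (t.1.2 - T t.2 t.1.2) := by
    have hm1 : Measurable fun t : (H × H) × I => T t.2 t.1.1 :=
      hΦ.comp (by fun_prop : Measurable fun t : (H × H) × I => (t.1.1, t.2))
    have hm2 : Measurable fun t : (H × H) × I => T t.2 t.1.2 :=
      hΦ.comp (by fun_prop : Measurable fun t : (H × H) × I => (t.1.2, t.2))
    exact ((measurable_fst.comp measurable_fst).sub hm1).q2
      ((measurable_snd.comp measurable_fst).sub hm2)
  rw [lintegral_map hm.lintegral_prod_right' (by fun_prop)]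
  simp [q2]

end RandomFunctionIteration

/-- let `Φ` be a contraction in expectation with constant `r < 1` on a
Hilbert space, with `E[‖Φ(y₀,ξ)-y₀‖²] < ∞` for some `y₀`, so that `𝒫` has a unique
invariant measure `π ∈ P₂(H)`.  If the Markov transport discrepancy satisfies
`Ψ(μ) ≥ q·W₂(μ𝒫, μ)` on `P₂(H)` for some `q > 0`, then `Ψ` is linearly metrically
subregular for `0` on `P₂(H)` with gauge `ρ(t) = t/(q(1-r))`:
`Ψ⁻¹(0) ∩ P₂(H) = {π}` and `q(1-r)·W₂(μ, π) ≤ Ψ(μ)` for all `μ ∈ P₂(H)`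
(stated in squared form). -/
theorem stmt14
    {H I : Type*} [NormedAddCommGroup H] [InnerProductSpace ℝ H] [CompleteSpace H]
    [SecondCountableTopology H] [MeasurableSpace H] [BorelSpace H] [MeasurableSpace I]
    (T : I → H → H)
    (hΦ : Measurable fun p : H × I => T p.2 p.1)
    (μξ : Measure I) [IsProbabilityMeasure μξ]
    (r : ℝ) (hr0 : 0 ≤ r) (hr1 : r < 1)
    (hcontr : ∀ x y : H,
      ∫⁻ i, q2 (T i x) (T i y) ∂μξ ≤ ENNReal.ofReal (r ^ 2) * q2 x y)
    (hfin : ∃ y₀ : H, ∫⁻ i, q2 (T i y₀) y₀ ∂μξ < ⊤)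
    (q : ℝ) (hq : 0 < q)
    (hΨ : ∀ μ : Measure H, MemP2 μ →
      ENNReal.ofReal (q ^ 2) * W2sq (markovStep μξ T μ) μ ≤ PsiSq μξ T μ) :
    ∃ π : Measure H, MemP2 π ∧ markovStep μξ T π = π ∧
      {μ : Measure H | MemP2 μ ∧ PsiSq μξ T μ = 0} = {π} ∧
      ∀ μ : Measure H, MemP2 μ →
        ENNReal.ofReal ((q * (1 - r)) ^ 2) * W2sq μ π ≤ PsiSq μξ T μ := by
  obtain ⟨π, hπ, hinv⟩ := exists_memP2_markovStep_eq hΦ (K := r.toNNReal)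
    (by simpa using hr1) (by rwa [ENNReal.ofReal_pow hr0] at hcontr) hfin
  have hbound : ∀ μ : Measure H, MemP2 μ →
      ENNReal.ofReal ((q * (1 - r)) ^ 2) * W2sq μ π ≤ PsiSq μξ T μ := by
    intro μ hμ
    rw [mul_pow, ENNReal.ofReal_mul (sq_nonneg q), mul_assoc]
    exact (mul_le_mul_right (mul_W2sq_le_W2sq_markovStep hΦ hr0 hr1 hcontr hμ hπ hinv) _).trans
      (hΨ μ hμ)
  refine ⟨π, hπ, hinv, ?_, hbound⟩
  ext μ
  simp only [Set.mem_ofPred_eq, Set.mem_singleton_iff]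
  constructor
  · rintro ⟨hμ, h0⟩
    have h := hbound μ hμ
    rw [h0, nonpos_iff_eq_zero, mul_eq_zero, ENNReal.ofReal_eq_zero] at h
    have := hμ.1
    have := hπ.1
    have hpos : 0 < (q * (1 - r)) ^ 2 := by
      have := sub_pos.2 hr1
      positivity
    exact eq_of_W2sq_eq_zero (h.resolve_left hpos.not_ge)
  · rintro rfl
    exact ⟨hπ, PsiSq_eq_zero ⟨hπ.1, hinv⟩ hΦ⟩
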